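/- Let M be a popular feasible matching in a marriage instance with critical men, and let ρ be an M-alternating cycle in G. Then the number of (+1,+1) edges of ρ is at most the number of (−1,−1) edges of ρ. -/

import Mathlib

open Classical

universe u v

/-- A marriage instance with critical men: a finite bipartite graph with edge set `E ⊆ A × B`,
a set `C ⊆ A` of critical men, and strict preference orders of each vertex over its
neighbours (`prefA m w w'` : man `m` strictly prefers woman `w` to woman `w'`;
`prefB w m m'` : woman `w` strictly prefers man `m` to man `m'`). -/
structure CritInstance (A : Type u) (B : Type v) where
  E : Finset (A × B)
  C : Finset A
  prefA : A → B → B → Prop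
  prefB : B → A → A → Prop
  prefA_irrefl : ∀ m w, ¬ prefA m w w
  prefA_trans : ∀ m w₁ w₂ w₃, prefA m w₁ w₂ → prefA m w₂ w₃ → prefA m w₁ w₃
  prefA_total : ∀ m w₁ w₂, (m, w₁) ∈ E → (m, w₂) ∈ E → w₁ ≠ w₂ →
    prefA m w₁ w₂ ∨ prefA m w₂ w₁
  prefB_irrefl : ∀ w m, ¬ prefB w m m
  prefB_trans : ∀ w m₁ m₂ m₃, prefB w m₁ m₂ → prefB w m₂ m₃ → prefB w m₁ m₃
  prefB_total : ∀ w m₁ m₂, (m₁, w) ∈ E → (m₂, w) ∈ E → m₁ ≠ m₂ →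
    prefB w m₁ m₂ ∨ prefB w m₂ m₁

namespace CritInstance

variable {A : Type u} {B : Type v}

/-- `M` is a matching: a set of edges in which every vertex has at most one partner. -/
def IsMatching (I : CritInstance A B) (M : Finset (A × B)) : Prop :=
  M ⊆ I.E ∧ (∀ ⦃m w w'⦄, (m, w) ∈ M → (m, w') ∈ M → w = w') ∧
    (∀ ⦃m m' w⦄, (m, w) ∈ M → (m', w) ∈ M → m = m')

/-- Man `m` is matched in `M`. -/
def ManMatched (M : Finset (A × B)) (m : A) : Prop := ∃ w, (m, w) ∈ M

/-- Woman `w` is matched in `M`. -/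
def WomanMatched (M : Finset (A × B)) (w : B) : Prop := ∃ m, (m, w) ∈ M

/-- `M` is feasible: it is a matching and every critical man is matched. -/
def IsFeasible (I : CritInstance A B) (M : Finset (A × B)) : Prop :=
  IsMatching I M ∧ ∀ m ∈ I.C, ManMatched M m

/-- Man `m` prefers matching `M` to matching `N`: he is matched in `M` and either
unmatched in `N` or strictly prefers his `M`-partner to his `N`-partner. -/
def ManPrefers (I : CritInstance A B) (M N : Finset (A × B)) (m : A) : Prop :=
  ∃ w, (m, w) ∈ M ∧ (¬ ManMatched N m ∨ ∃ w', (m, w') ∈ N ∧ I.prefA m w w')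

/-- Woman `w` prefers matching `M` to matching `N`. -/
def WomanPrefers (I : CritInstance A B) (M N : Finset (A × B)) (w : B) : Prop :=
  ∃ m, (m, w) ∈ M ∧ (¬ WomanMatched N w ∨ ∃ m', (m', w) ∈ N ∧ I.prefB w m m')

/-- `phi I M N` is the number of vertices that prefer `M` to `N`. -/
noncomputable def phi [Fintype A] [Fintype B] (I : CritInstance A B)
    (M N : Finset (A × B)) : ℕ :=
  (Finset.univ.filter fun m : A => ManPrefers I M N m).card +
    (Finset.univ.filter fun w : B => WomanPrefers I M N w).card

/-- `M` is a popular feasible matching. -/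
def IsPFM [Fintype A] [Fintype B] (I : CritInstance A B) (M : Finset (A × B)) : Prop :=
  IsFeasible I M ∧ ∀ N, IsFeasible I N → phi I N M ≤ phi I M N

/-- `M` is a minimum size popular feasible matching. -/
def IsMinPFM [Fintype A] [Fintype B] (I : CritInstance A B) (M : Finset (A × B)) : Prop :=
  IsPFM I M ∧ ∀ N, IsPFM I N → M.card ≤ N.card

/-- `M` is a dominant feasible matching. -/
def IsDFM [Fintype A] [Fintype B] (I : CritInstance A B) (M : Finset (A × B)) : Prop :=
  IsPFM I M ∧ ∀ N, IsFeasible I N → M.card < N.card → phi I N M < phi I M N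

/-- `(m,w)` is a `(+1,+1)` edge with respect to `M`: an edge of `E ∖ M` such that `m` is
unmatched or prefers `w` to his partner, and `w` is unmatched or prefers `m` to her partner. -/
def PlusPlus (I : CritInstance A B) (M : Finset (A × B)) (m : A) (w : B) : Prop :=
  (m, w) ∈ I.E ∧ (m, w) ∉ M ∧
    (¬ ManMatched M m ∨ ∃ w', (m, w') ∈ M ∧ I.prefA m w w') ∧
    (¬ WomanMatched M w ∨ ∃ m', (m', w) ∈ M ∧ I.prefB w m m')

/-- `(m,w)` is a `(−1,−1)` edge with respect to `M`: an edge of `E ∖ M` such that `m` is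
matched and prefers his partner to `w`, and `w` is matched and prefers her partner to `m`. -/
def MinusMinus (I : CritInstance A B) (M : Finset (A × B)) (m : A) (w : B) : Prop :=
  (m, w) ∈ I.E ∧ (m, w) ∉ M ∧
    (∃ w', (m, w') ∈ M ∧ I.prefA m w' w) ∧
    (∃ m', (m', w) ∈ M ∧ I.prefB w m' m)

/-- `M` is a stable matching: a matching with no blocking pair. -/
def IsStable (I : CritInstance A B) (M : Finset (A × B)) : Prop :=
  IsMatching I M ∧ ∀ m w, ¬ PlusPlus I M m w

/-- The min-size conditions for a level assignment `(lA, lB)` with respect to `M`: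
(i) matched partners share a level, unmatched vertices have level 0, non-critical men
have level 0; (ii) every `(+1,+1)` edge goes from a man to a strictly higher level woman;
(iii) every edge from a man at level `i` to a woman at level `i − 1` is a `(−1,−1)` edge;
(iv) no edge goes from a man at level `i` to a woman at level `≤ i − 2`. -/
def MinSizeConds (I : CritInstance A B) (M : Finset (A × B))
    (lA : A → ℕ) (lB : B → ℕ) : Prop :=
  (∀ m w, (m, w) ∈ M → lA m = lB w) ∧
  (∀ m, ¬ ManMatched M m → lA m = 0) ∧
  (∀ w, ¬ WomanMatched M w → lB w = 0) ∧
  (∀ m, m ∉ I.C → lA m = 0) ∧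
  (∀ m w, PlusPlus I M m w → lA m < lB w) ∧
  (∀ m w, (m, w) ∈ I.E → lB w + 1 = lA m → MinusMinus I M m w) ∧
  (∀ m w, (m, w) ∈ I.E → ¬ (lB w + 2 ≤ lA m))

/-- The dominant conditions for a level assignment `(lA, lB)` with respect to `M`:
(i) matched partners share a level, unmatched women have level 0, unmatched men have
level 1, non-critical men have level at most 1; (ii)–(iv) as in the min-size conditions. -/
def DomConds (I : CritInstance A B) (M : Finset (A × B))
    (lA : A → ℕ) (lB : B → ℕ) : Prop :=
  (∀ m w, (m, w) ∈ M → lA m = lB w) ∧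
  (∀ m, ¬ ManMatched M m → lA m = 1) ∧
  (∀ w, ¬ WomanMatched M w → lB w = 0) ∧
  (∀ m, m ∉ I.C → lA m ≤ 1) ∧
  (∀ m w, PlusPlus I M m w → lA m < lB w) ∧
  (∀ m w, (m, w) ∈ I.E → lB w + 1 = lA m → MinusMinus I M m w) ∧
  (∀ m w, (m, w) ∈ I.E → ¬ (lB w + 2 ≤ lA m))

/-- Adjacency in the bipartite graph, on the vertex set `A ⊕ B`. -/
def Adj (I : CritInstance A B) : A ⊕ B → A ⊕ B → Prop
  | Sum.inl m, Sum.inr w => (m, w) ∈ I.E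
  | Sum.inr w, Sum.inl m => (m, w) ∈ I.E
  | _, _ => False

/-- The (directed) pair `(u, v)` of vertices spans an edge of the matching `M`. -/
def StepM (M : Finset (A × B)) : A ⊕ B → A ⊕ B → Prop
  | Sum.inl m, Sum.inr w => (m, w) ∈ M
  | Sum.inr w, Sum.inl m => (m, w) ∈ M
  | _, _ => False

/-- The pair `(u, v)` of vertices spans a `(+1,+1)` edge with respect to `M`. -/
def StepPP (I : CritInstance A B) (M : Finset (A × B)) : A ⊕ B → A ⊕ B → Prop
  | Sum.inl m, Sum.inr w => PlusPlus I M m w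
  | Sum.inr w, Sum.inl m => PlusPlus I M m w
  | _, _ => False

/-- The pair `(u, v)` of vertices spans a `(−1,−1)` edge with respect to `M`. -/
def StepMM (I : CritInstance A B) (M : Finset (A × B)) : A ⊕ B → A ⊕ B → Prop
  | Sum.inl m, Sum.inr w => MinusMinus I M m w
  | Sum.inr w, Sum.inl m => MinusMinus I M m w
  | _, _ => False

/-- A vertex of `A ⊕ B` is matched in `M`. -/
def VMatched (M : Finset (A × B)) : A ⊕ B → Prop
  | Sum.inl m => ManMatched M m
  | Sum.inr w => WomanMatched M w

/-- An `M`-alternating path in the graph: a sequence of distinct vertices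
`vert 0, …, vert len` (`len ≥ 1` edges), consecutive vertices adjacent, with
consecutive edges alternately inside and outside `M`. -/
structure AltPath (I : CritInstance A B) (M : Finset (A × B)) where
  len : ℕ
  len_pos : 0 < len
  vert : ℕ → A ⊕ B
  inj : ∀ i j, i ≤ len → j ≤ len → vert i = vert j → i = j
  adj : ∀ i, i < len → Adj I (vert i) (vert (i + 1))
  alternate : ∀ i, i + 1 < len →
    (StepM M (vert i) (vert (i + 1)) ↔ ¬ StepM M (vert (i + 1)) (vert (i + 2)))

namespace AltPath

variable {I : CritInstance A B} {M : Finset (A × B)}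

/-- The number of `(+1,+1)` edges of the path. -/
noncomputable def countPP (ρ : AltPath I M) : ℕ :=
  ((Finset.range ρ.len).filter fun i => StepPP I M (ρ.vert i) (ρ.vert (i + 1))).card

/-- The number of `(−1,−1)` edges of the path. -/
noncomputable def countMM (ρ : AltPath I M) : ℕ :=
  ((Finset.range ρ.len).filter fun i => StepMM I M (ρ.vert i) (ρ.vert (i + 1))).card

/-- The vertex `u` lies on the path. -/
def Mem (ρ : AltPath I M) (u : A ⊕ B) : Prop := ∃ i ≤ ρ.len, ρ.vert i = u

/-- The set of edges of the path, as a set of pairs in `A × B`. -/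
noncomputable def edges (ρ : AltPath I M) : Finset (A × B) :=
  I.E.filter fun e => ∃ i < ρ.len,
    (ρ.vert i = Sum.inl e.1 ∧ ρ.vert (i + 1) = Sum.inr e.2) ∨
    (ρ.vert i = Sum.inr e.2 ∧ ρ.vert (i + 1) = Sum.inl e.1)

end AltPath

/-- An `M`-alternating cycle: a closed sequence of vertices `vert 0, …, vert len = vert 0`
(distinct except for the return), consecutive vertices adjacent, with edges alternately
inside and outside `M`, including around the wrap. -/
structure AltCycle (I : CritInstance A B) (M : Finset (A × B)) where
  len : ℕ
  len_pos : 0 < len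
  vert : ℕ → A ⊕ B
  closed : vert len = vert 0
  inj : ∀ i j, i < len → j < len → vert i = vert j → i = j
  adj : ∀ i, i < len → Adj I (vert i) (vert (i + 1))
  alternate : ∀ i, i + 1 < len →
    (StepM M (vert i) (vert (i + 1)) ↔ ¬ StepM M (vert (i + 1)) (vert (i + 2)))
  alternate_wrap : StepM M (vert (len - 1)) (vert len) ↔ ¬ StepM M (vert 0) (vert 1)

namespace AltCycle

variable {I : CritInstance A B} {M : Finset (A × B)}

/-- The number of `(+1,+1)` edges of the cycle. -/
noncomputable def countPP (σ : AltCycle I M) : ℕ :=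
  ((Finset.range σ.len).filter fun i => StepPP I M (σ.vert i) (σ.vert (i + 1))).card

/-- The number of `(−1,−1)` edges of the cycle. -/
noncomputable def countMM (σ : AltCycle I M) : ℕ :=
  ((Finset.range σ.len).filter fun i => StepMM I M (σ.vert i) (σ.vert (i + 1))).card

end AltCycle

/-- A size-increasing alternating path (SIAP) for `M`: an `M`-alternating path whose two
endpoints are a man unmatched in `M` and a woman unmatched in `M`, and which has equally
many `(+1,+1)` and `(−1,−1)` edges. -/
def IsSIAP (I : CritInstance A B) (M : Finset (A × B)) (ρ : AltPath I M) : Prop :=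
  (((∃ m, ρ.vert 0 = Sum.inl m ∧ ¬ ManMatched M m) ∧
      (∃ w, ρ.vert ρ.len = Sum.inr w ∧ ¬ WomanMatched M w)) ∨
    ((∃ w, ρ.vert 0 = Sum.inr w ∧ ¬ WomanMatched M w) ∧
      (∃ m, ρ.vert ρ.len = Sum.inl m ∧ ¬ ManMatched M m))) ∧
  ρ.countPP = ρ.countMM

/-- A size-reducing alternating path (SRAP) for `M` with respect to the level assignment
`(lA, lB)`: an `M`-alternating path both of whose terminal edges lie in `M`, starting at a
woman matched in `M` at level 0, ending at a non-critical man at level 1, whose number of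
`(+1,+1)` edges is exactly one more than its number of `(−1,−1)` edges. -/
def IsSRAP (I : CritInstance A B) (M : Finset (A × B)) (lA : A → ℕ) (lB : B → ℕ)
    (ρ : AltPath I M) : Prop :=
  StepM M (ρ.vert 0) (ρ.vert 1) ∧
  StepM M (ρ.vert (ρ.len - 1)) (ρ.vert ρ.len) ∧
  (((∃ w, ρ.vert 0 = Sum.inr w ∧ WomanMatched M w ∧ lB w = 0) ∧
      (∃ m, ρ.vert ρ.len = Sum.inl m ∧ m ∉ I.C ∧ lA m = 1)) ∨
    ((∃ m, ρ.vert 0 = Sum.inl m ∧ m ∉ I.C ∧ lA m = 1) ∧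
      (∃ w, ρ.vert ρ.len = Sum.inr w ∧ WomanMatched M w ∧ lB w = 0))) ∧
  ρ.countPP = ρ.countMM + 1

end CritInstance

namespace CritInstance

variable {A : Type u} {B : Type v}

theorem StepM.symm {M : Finset (A × B)} {x y : A ⊕ B} (h : StepM M x y) : StepM M y x := by
  cases x <;> cases y <;> exact h

theorem Adj.symm {I : CritInstance A B} {x y : A ⊕ B} (h : Adj I x y) : Adj I y x := by
  cases x <;> cases y <;> exact h

theorem IsMatching.stepM_unique {I : CritInstance A B} {M : Finset (A × B)}
    (hM : IsMatching I M) {x y z : A ⊕ B} (hy : StepM M x y) (hz : StepM M x z) : y = z := by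
  cases x <;> cases y <;> cases z <;> simp only [StepM] at hy hz
  · exact congrArg _ (hM.2.1 hy hz)
  · exact congrArg _ (hM.2.2 hy hz)

/-- A matching `R` disjoint from `M` along which `M` can be switched: the partner in `M` of every
vertex covered by `R` exists and is again covered by `R`. -/
structure IsSwitch (I : CritInstance A B) (M R : Finset (A × B)) : Prop where
  matching : IsMatching I R
  notMem : ∀ e ∈ R, e ∉ M
  man : ∀ m w, (m, w) ∈ R → ∃ w', (m, w') ∈ M ∧ WomanMatched R w'
  woman : ∀ m w, (m, w) ∈ R → ∃ m', (m', w) ∈ M ∧ ManMatched R m'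

/-- The result of switching `M` along `R`. -/
noncomputable def switch (M R : Finset (A × B)) : Finset (A × B) :=
  R ∪ M.filter fun e => ¬ ManMatched R e.1

theorem mem_switch {M R : Finset (A × B)} {m : A} {w : B} :
    (m, w) ∈ switch M R ↔ (m, w) ∈ R ∨ (m, w) ∈ M ∧ ¬ ManMatched R m := by
  simp [switch]

namespace IsSwitch

variable {I : CritInstance A B} {M R : Finset (A × B)}

theorem manMatched_iff (hR : IsSwitch I M R) (hM : IsMatching I M) {m : A} {w : B}
    (h : (m, w) ∈ M) : ManMatched R m ↔ WomanMatched R w := by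
  constructor
  · rintro ⟨w₁, h₁⟩
    obtain ⟨w', hw', hc⟩ := hR.man _ _ h₁
    rwa [hM.2.1 h hw']
  · rintro ⟨m₁, h₁⟩
    obtain ⟨m', hm', hc⟩ := hR.woman _ _ h₁
    rwa [hM.2.2 h hm']

theorem isFeasible_switch (hR : IsSwitch I M R) (hM : IsFeasible I M) :
    IsFeasible I (switch M R) := by
  refine ⟨⟨?_, ?_, ?_⟩, ?_⟩
  · rintro ⟨m, w⟩ h
    rcases mem_switch.1 h with h | h
    · exact hR.matching.1 h
    · exact hM.1.1 h.1
  · intro m w w' h h'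
    rcases mem_switch.1 h with h | h <;> rcases mem_switch.1 h' with h' | h'
    · exact hR.matching.2.1 h h'
    · exact absurd ⟨_, h⟩ h'.2
    · exact absurd ⟨_, h'⟩ h.2
    · exact hM.1.2.1 h.1 h'.1
  · intro m m' w h h'
    rcases mem_switch.1 h with h | h <;> rcases mem_switch.1 h' with h' | h'
    · exact hR.matching.2.2 h h'
    · exact absurd ((hR.manMatched_iff hM.1 h'.1).2 ⟨_, h⟩) h'.2
    · exact absurd ((hR.manMatched_iff hM.1 h.1).2 ⟨_, h'⟩) h.2
    · exact hM.1.2.2 h.1 h'.1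
  · intro m hm
    by_cases hc : ManMatched R m
    · exact hc.imp fun w hw => mem_switch.2 (Or.inl hw)
    · exact (hM.2 m hm).imp fun w hw => mem_switch.2 (Or.inr ⟨hw, hc⟩)

theorem prefersA_iff (hR : IsSwitch I M R) (hM : IsMatching I M) {e : A × B} (he : e ∈ R) :
    (∃ w', (e.1, w') ∈ M ∧ I.prefA e.1 w' e.2) ↔
      ¬ ∃ w', (e.1, w') ∈ M ∧ I.prefA e.1 e.2 w' := by
  obtain ⟨w, hw, -⟩ := hR.man _ _ he
  constructor
  · rintro ⟨w₁, h₁, p₁⟩ ⟨w₂, h₂, p₂⟩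
    cases hM.2.1 h₁ h₂
    exact I.prefA_irrefl _ _ (I.prefA_trans _ _ _ _ p₁ p₂)
  · intro h
    have hne : w ≠ e.2 := by
      rintro rfl
      exact hR.notMem _ he hw
    exact ⟨w, hw, (I.prefA_total _ _ _ (hM.1 hw) (hR.matching.1 he) hne).resolve_right
      fun p => h ⟨w, hw, p⟩⟩

theorem prefersB_iff (hR : IsSwitch I M R) (hM : IsMatching I M) {e : A × B} (he : e ∈ R) :
    (∃ m', (m', e.2) ∈ M ∧ I.prefB e.2 m' e.1) ↔
      ¬ ∃ m', (m', e.2) ∈ M ∧ I.prefB e.2 e.1 m' := by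
  obtain ⟨m, hm, -⟩ := hR.woman _ _ he
  constructor
  · rintro ⟨m₁, h₁, p₁⟩ ⟨m₂, h₂, p₂⟩
    cases hM.2.2 h₁ h₂
    exact I.prefB_irrefl _ _ (I.prefB_trans _ _ _ _ p₁ p₂)
  · intro h
    have hne : m ≠ e.1 := by
      rintro rfl
      exact hR.notMem _ he hm
    exact ⟨m, hm, (I.prefB_total _ _ _ (hM.1 hm) (hR.matching.1 he) hne).resolve_right
      fun p => h ⟨m, hm, p⟩⟩

variable [Fintype A] [Fintype B]

theorem card_le_phi_switch (hR : IsSwitch I M R) :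
    (R.filter fun e => ∃ w', (e.1, w') ∈ M ∧ I.prefA e.1 e.2 w').card +
      (R.filter fun e => ∃ m', (m', e.2) ∈ M ∧ I.prefB e.2 e.1 m').card ≤
      phi I (switch M R) M := by
  refine add_le_add (Finset.card_le_card_of_injOn Prod.fst ?_ ?_)
    (Finset.card_le_card_of_injOn Prod.snd ?_ ?_)
  · rintro ⟨m, w⟩ h
    simp only [Finset.coe_filter, Set.mem_ofPred_eq, Finset.mem_univ, true_and] at h ⊢
    exact ⟨w, mem_switch.2 (Or.inl h.1), Or.inr h.2⟩
  · rintro ⟨m, w⟩ h ⟨m', w'⟩ h' (rfl : m = m')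
    simp only [Finset.coe_filter, Set.mem_ofPred_eq] at h h'
    rw [hR.matching.2.1 h.1 h'.1]
  · rintro ⟨m, w⟩ h
    simp only [Finset.coe_filter, Set.mem_ofPred_eq, Finset.mem_univ, true_and] at h ⊢
    exact ⟨m, mem_switch.2 (Or.inl h.1), Or.inr h.2⟩
  · rintro ⟨m, w⟩ h ⟨m', w'⟩ h' (rfl : w = w')
    simp only [Finset.coe_filter, Set.mem_ofPred_eq] at h h'
    rw [hR.matching.2.2 h.1 h'.1]

theorem phi_switch_le_card (hR : IsSwitch I M R) (hM : IsMatching I M) :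
    phi I M (switch M R) ≤
      (R.filter fun e => ∃ w', (e.1, w') ∈ M ∧ I.prefA e.1 w' e.2).card +
        (R.filter fun e => ∃ m', (m', e.2) ∈ M ∧ I.prefB e.2 m' e.1).card := by
  refine add_le_add
    ((Finset.card_le_card fun m hm => ?_).trans (Finset.card_image_le (f := Prod.fst)))
    ((Finset.card_le_card fun w hw => ?_).trans (Finset.card_image_le (f := Prod.snd)))
  · obtain ⟨w, hw, h⟩ := (Finset.mem_filter.1 hm).2
    have hmN : ManMatched (switch M R) m := by
      by_cases hc : ManMatched R m
      · exact hc.imp fun w hw => mem_switch.2 (Or.inl hw)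
      · exact ⟨w, mem_switch.2 (Or.inr ⟨hw, hc⟩)⟩
    obtain ⟨w', hw', hp⟩ := h.resolve_left (not_not_intro hmN)
    rcases mem_switch.1 hw' with h' | h'
    · exact Finset.mem_image.2 ⟨(m, w'), Finset.mem_filter.2 ⟨h', w, hw, hp⟩, rfl⟩
    · cases hM.2.1 hw h'.1
      exact absurd hp (I.prefA_irrefl _ _)
  · obtain ⟨m, hm, h⟩ := (Finset.mem_filter.1 hw).2
    have hwN : WomanMatched (switch M R) w := by
      by_cases hc : WomanMatched R w
      · exact hc.imp fun m hm => mem_switch.2 (Or.inl hm)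
      · exact ⟨m, mem_switch.2 (Or.inr ⟨hm, fun h => hc ((hR.manMatched_iff hM hm).1 h)⟩)⟩
    obtain ⟨m', hm', hp⟩ := h.resolve_left (not_not_intro hwN)
    rcases mem_switch.1 hm' with h' | h'
    · exact Finset.mem_image.2 ⟨(m', w), Finset.mem_filter.2 ⟨h', m, hm, hp⟩, rfl⟩
    · cases hM.2.2 hm h'.1
      exact absurd hp (I.prefB_irrefl _ _)

theorem card_plusPlus_le_card_minusMinus (hR : IsSwitch I M R) (hM : IsPFM I M) :
    (R.filter fun e => PlusPlus I M e.1 e.2).card ≤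
      (R.filter fun e => MinusMinus I M e.1 e.2).card := by
  have hvote := (hR.card_le_phi_switch.trans (hM.2 _ (hR.isFeasible_switch hM.1))).trans
    (hR.phi_switch_le_card hM.1.1)
  have key : ∀ e ∈ R,
      (if ∃ w', (e.1, w') ∈ M ∧ I.prefA e.1 e.2 w' then 1 else 0) +
        (if ∃ m', (m', e.2) ∈ M ∧ I.prefB e.2 e.1 m' then 1 else 0) +
        2 * (if MinusMinus I M e.1 e.2 then 1 else 0) =
      (if ∃ w', (e.1, w') ∈ M ∧ I.prefA e.1 w' e.2 then 1 else 0) +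
        (if ∃ m', (m', e.2) ∈ M ∧ I.prefB e.2 m' e.1 then 1 else 0) +
        2 * (if PlusPlus I M e.1 e.2 then 1 else 0) := by
    intro e he
    have hm : ManMatched M e.1 := (hR.man _ _ he).imp fun _ h => h.1
    have hw : WomanMatched M e.2 := (hR.woman _ _ he).imp fun _ h => h.1
    have heE : (e.1, e.2) ∈ I.E := hR.matching.1 he
    have heM : (e.1, e.2) ∉ M := hR.notMem _ he
    simp only [PlusPlus, MinusMinus, hm, hw, heE, heM, hR.prefersA_iff hM.1.1 he,
      hR.prefersB_iff hM.1.1 he, not_true_eq_false, not_false_eq_true, true_and, false_or]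
    by_cases h₁ : ∃ w', (e.1, w') ∈ M ∧ I.prefA e.1 e.2 w' <;>
      by_cases h₂ : ∃ m', (m', e.2) ∈ M ∧ I.prefB e.2 e.1 m' <;> simp only [h₁, h₂] <;> simp
  have hsum := Finset.sum_congr rfl key
  simp only [Finset.sum_add_distrib, ← Finset.mul_sum, ← Finset.card_filter] at hsum
  omega

end IsSwitch

namespace AltCycle

variable {I : CritInstance A B} {M : Finset (A × B)} (σ : AltCycle I M)

instance : NeZero σ.len := ⟨σ.len_pos.ne'⟩

theorem two_lt_len : 2 < σ.len := by
  have hpos := σ.len_pos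
  by_contra h
  have hc := σ.closed
  obtain h₁ | h₂ : σ.len = 1 ∨ σ.len = 2 := by omega
  · have ha := σ.adj 0 hpos
    rw [h₁] at hc
    rw [zero_add, hc] at ha
    cases hv : σ.vert 0 <;> simp [hv, Adj] at ha
  · have ha := σ.alternate 0 (by omega)
    rw [h₂] at hc
    simp only [zero_add, hc] at ha
    have : StepM M (σ.vert 0) (σ.vert 1) ↔ StepM M (σ.vert 1) (σ.vert 0) :=
      ⟨StepM.symm, StepM.symm⟩
    tauto

/-- The vertices of the cycle, indexed cyclically. -/
def cyc (k : ZMod σ.len) : A ⊕ B := σ.vert k.val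

theorem cyc_injective : Function.Injective σ.cyc := fun k l h =>
  ZMod.val_injective _ (σ.inj _ _ k.val_lt l.val_lt h)

theorem cyc_natCast {i : ℕ} (hi : i ≤ σ.len) : σ.cyc i = σ.vert i := by
  rw [cyc, ZMod.val_natCast]
  rcases hi.lt_or_eq with h | h
  · rw [Nat.mod_eq_of_lt h]
  · rw [h, Nat.mod_self, σ.closed]

theorem exists_natCast (k : ZMod σ.len) : ∃ i < σ.len, (i : ZMod σ.len) = k :=
  ⟨k.val, k.val_lt, ZMod.natCast_zmod_val k⟩

theorem cyc_natCast_add_one {i : ℕ} (hi : i < σ.len) :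
    σ.cyc ((i : ZMod σ.len) + 1) = σ.vert (i + 1) := by
  exact_mod_cast σ.cyc_natCast (i := i + 1) hi

theorem adj_cyc (k : ZMod σ.len) : Adj I (σ.cyc k) (σ.cyc (k + 1)) := by
  obtain ⟨i, hi, rfl⟩ := σ.exists_natCast k
  rw [σ.cyc_natCast_add_one hi, σ.cyc_natCast hi.le]
  exact σ.adj i hi

theorem alternate_cyc (k : ZMod σ.len) :
    StepM M (σ.cyc k) (σ.cyc (k + 1)) ↔ ¬ StepM M (σ.cyc (k + 1)) (σ.cyc (k + 1 + 1)) := by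
  obtain ⟨i, hi, rfl⟩ := σ.exists_natCast k
  rw [σ.cyc_natCast_add_one hi, σ.cyc_natCast hi.le]
  obtain h | h : i + 1 < σ.len ∨ i + 1 = σ.len := by omega
  · have := σ.cyc_natCast_add_one h
    push_cast at this
    rw [this]
    exact σ.alternate i h
  · have h0 : (i : ZMod σ.len) + 1 = ((0 : ℕ) : ZMod σ.len) := by
      have : ((i + 1 : ℕ) : ZMod σ.len) = 0 := by rw [h, ZMod.natCast_self]
      simpa using this
    rw [h0, σ.cyc_natCast_add_one σ.len_pos, h, σ.closed]
    have := σ.alternate_wrap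
    rwa [σ.closed, ← h, Nat.add_sub_cancel] at this

/-- Two vertices are joined by an edge of the cycle outside `M`. -/
def OffStep (x y : A ⊕ B) : Prop :=
  ¬ StepM M x y ∧ ∃ k, x = σ.cyc k ∧ y = σ.cyc (k + 1) ∨ y = σ.cyc k ∧ x = σ.cyc (k + 1)

variable {σ}

theorem OffStep.symm {x y : A ⊕ B} (h : σ.OffStep x y) : σ.OffStep y x :=
  ⟨fun h' => h.1 h'.symm, h.2.imp fun _ => Or.symm⟩

theorem OffStep.adj {x y : A ⊕ B} (h : σ.OffStep x y) : Adj I x y := by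
  obtain ⟨-, k, ⟨rfl, rfl⟩ | ⟨rfl, rfl⟩⟩ := h
  · exact σ.adj_cyc k
  · exact (σ.adj_cyc k).symm

theorem OffStep.unique {x y z : A ⊕ B} (hy : σ.OffStep x y) (hz : σ.OffStep x z) : y = z := by
  obtain ⟨hy, k, ⟨rfl, rfl⟩ | ⟨rfl, rfl⟩⟩ := hy <;>
    obtain ⟨hz, l, ⟨h, rfl⟩ | ⟨rfl, h⟩⟩ := hz <;> have h := σ.cyc_injective h
  · rw [h]
  · subst h
    exact absurd ((σ.alternate_cyc l).2 hy) fun h => hz h.symm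
  · subst h
    exact absurd ((σ.alternate_cyc k).2 hz) fun h => hy h.symm
  · rw [add_right_cancel h]

theorem exists_offStep (k : ZMod σ.len) : ∃ y, σ.OffStep (σ.cyc k) y := by
  by_cases h : StepM M (σ.cyc k) (σ.cyc (k + 1))
  · refine ⟨σ.cyc (k - 1), fun h' => ?_, k - 1, Or.inr ⟨rfl, by rw [sub_add_cancel]⟩⟩
    have := σ.alternate_cyc (k - 1)
    rw [sub_add_cancel] at this
    exact this.1 h'.symm h
  · exact ⟨_, h, k, Or.inl ⟨rfl, rfl⟩⟩

theorem OffStep.exists_stepM {x y : A ⊕ B} (h : σ.OffStep x y) :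
    ∃ z, StepM M x z ∧ ∃ t, σ.OffStep z t := by
  obtain ⟨h, k, ⟨rfl, rfl⟩ | ⟨rfl, rfl⟩⟩ := h
  · refine ⟨σ.cyc (k - 1), ?_, exists_offStep _⟩
    have := σ.alternate_cyc (k - 1)
    rw [sub_add_cancel] at this
    exact (this.2 h).symm
  · refine ⟨σ.cyc (k + 1 + 1), ?_, exists_offStep _⟩
    by_contra h'
    exact h ((σ.alternate_cyc k).2 h').symm

variable (σ)

/-- The edges of the cycle outside `M`. -/
noncomputable def offEdges : Finset (A × B) :=
  I.E.filter fun e => σ.OffStep (Sum.inl e.1) (Sum.inr e.2)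

theorem mem_offEdges {m : A} {w : B} :
    (m, w) ∈ σ.offEdges ↔ σ.OffStep (Sum.inl m) (Sum.inr w) := by
  rw [offEdges, Finset.mem_filter, and_iff_right_iff_imp]
  exact fun h => h.adj

theorem isSwitch_offEdges : IsSwitch I M σ.offEdges where
  matching := by
    refine ⟨Finset.filter_subset _ _, fun m w w' h h' => ?_, fun m m' w h h' => ?_⟩ <;>
      rw [mem_offEdges] at h h'
    · exact Sum.inr_injective (h.unique h')
    · exact Sum.inl_injective (h.symm.unique h'.symm)
  notMem := fun ⟨m, w⟩ h => (σ.mem_offEdges.1 h).1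
  man := by
    intro m w h
    obtain ⟨z, hz, t, ht⟩ := (σ.mem_offEdges.1 h).exists_stepM
    rcases z with z | z
    · exact hz.elim
    rcases t with t | t
    · exact ⟨z, hz, t, σ.mem_offEdges.2 ht.symm⟩
    · exact ht.adj.elim
  woman := by
    intro m w h
    obtain ⟨z, hz, t, ht⟩ := (σ.mem_offEdges.1 h).symm.exists_stepM
    rcases z with z | z
    · rcases t with t | t
      · exact ht.adj.elim
      · exact ⟨z, hz, t, σ.mem_offEdges.2 ht⟩
    · exact hz.elim

theorem eq_of_edge_eq {i j : ℕ} (hi : i < σ.len) (hj : j < σ.len)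
    (h : s(σ.vert i, σ.vert (i + 1)) = s(σ.vert j, σ.vert (j + 1))) : i = j := by
  rcases Sym2.eq_iff.1 h with ⟨h, -⟩ | ⟨h₁, h₂⟩
  · exact σ.inj _ _ hi hj h
  · rw [← σ.cyc_natCast hi.le, ← σ.cyc_natCast_add_one hj] at h₁
    rw [← σ.cyc_natCast hj.le, ← σ.cyc_natCast_add_one hi] at h₂
    have h₁ := σ.cyc_injective h₁
    have h₂ := σ.cyc_injective h₂
    have h0 : ((2 : ℕ) : ZMod σ.len) = 0 := by
      rw [← h₂] at h₁
      push_cast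
      linear_combination -h₁
    have := Nat.le_of_dvd two_pos ((ZMod.natCast_eq_zero_iff _ _).1 h0)
    have := σ.two_lt_len
    omega

theorem countPP_le_card :
    σ.countPP ≤ (σ.offEdges.filter fun e => PlusPlus I M e.1 e.2).card := by
  have H : ∀ i ∈ (Finset.range σ.len).filter fun i => StepPP I M (σ.vert i) (σ.vert (i + 1)),
      ∃ e ∈ σ.offEdges.filter fun e => PlusPlus I M e.1 e.2,
        s(Sum.inl e.1, Sum.inr e.2) = s(σ.vert i, σ.vert (i + 1)) := by
    intro i hi
    rw [Finset.mem_filter, Finset.mem_range] at hi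
    obtain ⟨hi, h⟩ := hi
    have e₀ := σ.cyc_natCast hi.le
    have e₁ := σ.cyc_natCast_add_one hi
    rcases hx : σ.vert i with m | w <;> rcases hy : σ.vert (i + 1) with m' | w' <;>
      simp only [hx, hy, StepPP] at h
    · exact ⟨(m, w'), Finset.mem_filter.2 ⟨σ.mem_offEdges.2 ⟨h.2.1, i,
        Or.inl ⟨(e₀.trans hx).symm, (e₁.trans hy).symm⟩⟩, h⟩, rfl⟩
    · exact ⟨(m', w), Finset.mem_filter.2 ⟨σ.mem_offEdges.2 ⟨h.2.1, i,
        Or.inr ⟨(e₀.trans hx).symm, (e₁.trans hy).symm⟩⟩, h⟩, Sym2.eq_swap⟩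
  refine Finset.card_le_card_of_forall_subsingleton _ H fun e _ i hi j hj => ?_
  exact σ.eq_of_edge_eq (Finset.mem_range.1 (Finset.mem_filter.1 hi.1).1)
    (Finset.mem_range.1 (Finset.mem_filter.1 hj.1).1) (hi.2.symm.trans hj.2)

theorem card_le_countMM :
    (σ.offEdges.filter fun e => MinusMinus I M e.1 e.2).card ≤ σ.countMM := by
  have H : ∀ e ∈ σ.offEdges.filter fun e => MinusMinus I M e.1 e.2,
      ∃ i ∈ (Finset.range σ.len).filter fun i => StepMM I M (σ.vert i) (σ.vert (i + 1)),
        s(Sum.inl e.1, Sum.inr e.2) = s(σ.vert i, σ.vert (i + 1)) := by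
    rintro ⟨m, w⟩ he
    obtain ⟨he, h⟩ := Finset.mem_filter.1 he
    obtain ⟨-, k, hk⟩ := σ.mem_offEdges.1 he
    obtain ⟨i, hi, rfl⟩ := σ.exists_natCast k
    rw [σ.cyc_natCast_add_one hi, σ.cyc_natCast hi.le] at hk
    refine ⟨i, Finset.mem_filter.2 ⟨Finset.mem_range.2 hi, ?_⟩, ?_⟩ <;>
      obtain ⟨h₁, h₂⟩ | ⟨h₁, h₂⟩ := hk <;> rw [← h₁, ← h₂]
    · exact h
    · exact h
    · exact Sym2.eq_swap
  choose! f hf hfe using H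
  refine Finset.card_le_card_of_injOn f hf fun e he e' he' h => ?_
  have := (hfe e he).trans (h ▸ (hfe e' he').symm)
  rcases Sym2.eq_iff.1 this with ⟨h₁, h₂⟩ | ⟨h₁, -⟩
  · exact Prod.ext (Sum.inl_injective h₁) (Sum.inr_injective h₂)
  · cases h₁

end AltCycle

end CritInstance

/-- If `M` is a popular feasible matching, then every `M`-alternating
cycle has at most as many `(+1,+1)` edges as `(−1,−1)` edges. -/
theorem altCycle_countPP_le_countMM {A : Type u} {B : Type v} [Fintype A] [Fintype B]
    (I : CritInstance A B) (M : Finset (A × B)) (hM : I.IsPFM M)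
    (σ : CritInstance.AltCycle I M) :
    σ.countPP ≤ σ.countMM :=
  (σ.countPP_le_card.trans (σ.isSwitch_offEdges.card_plusPlus_le_card_minusMinus hM)).trans
    σ.card_le_countMM
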